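/- arXiv:2406.07468 — 2 statements merged into one kernel-verified Lean document; each statement's English description precedes it below -/
import Mathlib

section
/- Let n ≥ 4 be even, q = 2^n, α ∈ 𝔽_q^*, and let k = |R-Spec_q(F_{0,α})|. Then APN-def(F_{0,α}) = 9(q−1) − k when n ≡ 2 (mod 4), and APN-def(F_{0,α}) = 9(q−1) − k − 18 when n ≡ 0 (mod 4). In particular, in both cases APN-def(F_{0,α}) = APN-def(F) − k and APN-def(F) − k − 18 respectively, where F(x) = x^{q−2} is the inverse function. -/
namespace APNPaper

open Finset

variable {F : Type*} [Field F] [Fintype F] [DecidableEq F]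

/-- `δ_G(a,b)`: the number of `x` with `D_aG(x) = G(x) + G(x+a) = b`. -/
def delta (G : F → F) (a b : F) : ℕ :=
  (Finset.univ.filter fun x : F => G x + G (x + a) = b).card

/-- `∇_G(a,x) = δ_G(a, D_aG(x))`. -/
def nabla (G : F → F) (a x : F) : ℕ := delta G a (G x + G (x + a))

/-- `G` is almost perfect nonlinear. -/
def IsAPN (G : F → F) : Prop := ∀ a : F, a ≠ 0 → ∀ b : F, delta G a b ≤ 2

/-- The derivative `D_aG` is 2-to-1, i.e. `G` satisfies property `(p_a)`. -/
def TwoToOne (G : F → F) (a : F) : Prop :=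
  ∀ b : F, delta G a b = 0 ∨ delta G a b = 2

instance instDecTwoToOne (G : F → F) (a : F) : Decidable (TwoToOne G a) := by
  unfold TwoToOne; infer_instance

/-- The row spectrum `R-Spec_q(G)`. -/
def RSpec (G : F → F) : Finset F :=
  (Finset.univ.erase (0 : F)).filter fun a => TwoToOne G a

/-- `S_a = {x : ∇_G(a,x) = 2}`. -/
def Sset (G : F → F) (a : F) : Finset F :=
  Finset.univ.filter fun x : F => nabla G a x = 2

/-- `w_{S_a^c} = Σ_{b : δ_G(a,b) > 2} (δ_G(a,b)/2)²`. -/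
def wS (G : F → F) (a : F) : ℤ :=
  ∑ b : F, if 2 < delta G a b then ((delta G a b / 2 : ℕ) : ℤ) ^ 2 else 0

/-- `χ_a = 1` if `S_a = 𝔽_q`, and `0` otherwise. -/
def chi (G : F → F) (a : F) : ℤ :=
  if Sset G a = Finset.univ then 1 else 0

/-- `𝒟(G) = Σ_{a ≠ 0} (|S_a| − w_{S_a^c} + χ_a)`. -/
def Dscr (G : F → F) : ℤ :=
  ∑ a ∈ Finset.univ.erase (0 : F), (((Sset G a).card : ℤ) - wS G a + chi G a)

/-- The APN-defect `APN-def(G) = q² − 1 − 𝒟(G)`. -/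
def APNdef (G : F → F) : ℤ := (Fintype.card F : ℤ) ^ 2 - 1 - Dscr G

/-- The differential uniformity `δ_G`. -/
def diffUnif (G : F → F) : ℕ :=
  ((Finset.univ.erase (0 : F)) ×ˢ Finset.univ).sup fun p => delta G p.1 p.2

/-- The set of vanishing flats of `G`. -/
def VF (G : F → F) : Set (Finset F) :=
  {S | ∃ x y z : F, x ≠ y ∧ x ≠ z ∧ y ≠ z ∧
    G x + G y + G z + G (x + y + z) = 0 ∧ S = ({x, y, z, x + y + z} : Finset F)}

/-- The absolute trace `Tr(z) = z + z² + ⋯ + z^{2^{n-1}}` (with values in `{0,1} ⊆ F`). -/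
def Tr (n : ℕ) (z : F) : F := ∑ i ∈ Finset.range n, z ^ (2 ^ i)

/-- The modification `F_{0,α}` of the inverse function: the values of the inverse
function at `0` and `α` are swapped. -/
def Fmod (α : F) : F → F :=
  fun x => if x = 0 then α⁻¹ else if x = α then 0 else x⁻¹

set_option linter.unusedSectionVars false

/-- The contribution of a value `b` with `δ_G(a,b) = d` to the APN-defect. -/
def weight (d : ℕ) : ℤ := if 2 < d then (d : ℤ) + ((d / 2 : ℕ) : ℤ) ^ 2 else 0

/-- The contribution of the direction `a` to the APN-defect, up to the `χ_a` term. -/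
def rowWeight (G : F → F) (a : F) : ℤ := ∑ b : F, weight (delta G a b)

theorem add_add_self [CharP F 2] (x a : F) : x + a + a = x := by
  rw [add_assoc, CharTwo.add_self_eq_zero, add_zero]

theorem add_self_ne [CharP F 2] {a : F} (ha : a ≠ 0) (x : F) : x ≠ x + a := by
  simpa using ha

theorem delta_ne_one [CharP F 2] (G : F → F) {a : F} (ha : a ≠ 0) (b : F) :
    delta G a b ≠ 1 := by
  intro h
  obtain ⟨x, hx⟩ := Finset.card_eq_one.mp h
  have h1 : x ∈ ({x} : Finset F) := by simp
  have h2 : x + a ∈ ({x} : Finset F) := by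
    rw [← hx] at h1 ⊢
    simp only [mem_filter, mem_univ, true_and] at h1 ⊢
    rw [add_add_self, add_comm, h1]
  simp [ha] at h2

theorem sum_delta (G : F → F) (a : F) : ∑ b : F, (delta G a b : ℤ) = Fintype.card F := by
  have := Finset.card_eq_sum_card_fiberwise (s := (univ : Finset F)) (t := univ)
    (f := fun x => G x + G (x + a)) (by simp)
  rw [Finset.card_univ] at this
  rw [this]
  push_cast
  rfl

theorem card_Sset (G : F → F) (a : F) :
    ((Sset G a).card : ℤ) = ∑ b : F, if delta G a b = 2 then (delta G a b : ℤ) else 0 := by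
  have := Finset.card_eq_sum_card_fiberwise (s := Sset G a) (t := univ)
    (f := fun x => G x + G (x + a)) (by simp)
  rw [this]
  push_cast
  refine Finset.sum_congr rfl fun b _ => ?_
  split_ifs with h
  · unfold delta Sset nabla
    congr 2
    ext x
    simp only [mem_filter, mem_univ, true_and, and_iff_right_iff_imp]
    rintro rfl
    exact h
  · simp only [Nat.cast_eq_zero, Finset.card_eq_zero, Finset.filter_eq_empty_iff]
    rintro x hx rfl
    exact h (mem_filter.mp hx).2

theorem Sset_eq_univ_iff (G : F → F) (a : F) : Sset G a = univ ↔ TwoToOne G a := by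
  rw [Sset, Finset.filter_eq_self]
  constructor
  · intro h b
    by_cases hb : ∃ x, G x + G (x + a) = b
    · obtain ⟨x, rfl⟩ := hb
      exact Or.inr (h x (mem_univ x))
    · push Not at hb
      left
      simpa [delta, Finset.filter_eq_empty_iff] using hb
  · intro h x _
    refine (h _).resolve_left ?_
    simp only [delta, Finset.card_eq_zero, Finset.filter_eq_empty_iff, mem_univ, true_imp_iff]
    exact fun h => h (x := x) rfl

theorem card_Sset_sub_wS [CharP F 2] (G : F → F) {a : F} (ha : a ≠ 0) :
    ((Sset G a).card : ℤ) - wS G a = Fintype.card F - rowWeight G a := by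
  rw [card_Sset, wS, rowWeight, ← sum_delta G a, ← Finset.sum_sub_distrib,
    ← Finset.sum_sub_distrib]
  refine Finset.sum_congr rfl fun b _ => ?_
  have h1 := delta_ne_one G ha b
  unfold weight
  rcases lt_trichotomy (delta G a b) 2 with h | h | h
  · have h0 : delta G a b = 0 := by omega
    simp [h0]
  · simp [h]
  · simp only [h, h.ne', if_true, if_false]
    ring

theorem APNdef_eq [CharP F 2] (G : F → F) :
    APNdef G = ∑ a ∈ univ.erase (0 : F), rowWeight G a + (Fintype.card F - 1)
      - (RSpec G).card := by
  have hD : Dscr G = ∑ a ∈ univ.erase (0 : F),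
      ((Fintype.card F : ℤ) - rowWeight G a + if TwoToOne G a then 1 else 0) := by
    refine Finset.sum_congr rfl fun a ha => ?_
    rw [card_Sset_sub_wS G (Finset.ne_of_mem_erase ha), chi]
    simp only [Sset_eq_univ_iff]
  have hR : ((RSpec G).card : ℤ) = ∑ a ∈ univ.erase (0 : F), if TwoToOne G a then 1 else 0 := by
    rw [RSpec, Finset.card_filter]
    push_cast
    rfl
  have hc : (((univ : Finset F).erase 0).card : ℤ) = Fintype.card F - 1 := by
    rw [Finset.card_erase_of_mem (mem_univ _), Finset.card_univ,
      Nat.cast_sub Fintype.card_pos, Nat.cast_one]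
  rw [APNdef, hD, Finset.sum_add_distrib, Finset.sum_sub_distrib, ← hR, Finset.sum_const,
    nsmul_eq_mul, hc]
  ring

theorem delta_Fmod_scale {α : F} (hα : α ≠ 0) (a b : F) :
    delta (Fmod α) (α * a) (α⁻¹ * b) = delta (Fmod 1) a b := by
  have hF : ∀ x : F, Fmod α (α * x) = α⁻¹ * Fmod 1 x := by
    intro x
    by_cases h0 : x = 0
    · simp [Fmod, h0]
    · by_cases h1 : x = 1 <;> simp [Fmod, h0, h1, hα, mul_comm]
  symm
  refine Finset.card_bij (fun x _ => α * x) ?_ ?_ ?_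
  · intro x hx
    simp only [mem_filter, mem_univ, true_and] at hx ⊢
    rw [← mul_add, hF, hF, ← hx, mul_add]
  · intro x _ y _ h
    exact mul_left_cancel₀ hα h
  · intro y hy
    refine ⟨α⁻¹ * y, ?_, by simp [hα]⟩
    simp only [mem_filter, mem_univ, true_and] at hy ⊢
    have hy' : y = α * (α⁻¹ * y) := by simp [hα]
    rw [hy', ← mul_add, hF, hF, ← mul_add] at hy
    exact mul_left_cancel₀ (inv_ne_zero hα) hy

theorem sum_rowWeight_Fmod {α : F} (hα : α ≠ 0) :
    ∑ a ∈ univ.erase (0 : F), rowWeight (Fmod α) a =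
      ∑ a ∈ univ.erase (0 : F), rowWeight (Fmod (1 : F)) a := by
  symm
  refine Finset.sum_bij (fun x _ => α * x) ?_ ?_ ?_ ?_
  · intro x hx
    simpa [hα] using hx
  · intro x _ y _ h
    exact mul_left_cancel₀ hα h
  · intro y hy
    exact ⟨α⁻¹ * y, by simpa [hα] using hy, by simp [hα]⟩
  · intro a _
    refine Fintype.sum_equiv (Equiv.mulLeft₀ α⁻¹ (inv_ne_zero hα)) _ _ fun b => ?_
    simp [delta_Fmod_scale hα]

theorem inv_add_inv_eq_iff [CharP F 2] {x a b : F} (hx : x ≠ 0) (hxa : x + a ≠ 0) :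
    x⁻¹ + (x + a)⁻¹ = b ↔ a = b * (x * (x + a)) := by
  rw [inv_add_inv hx hxa, div_eq_iff (mul_ne_zero hx hxa), ← add_assoc,
    CharTwo.add_self_eq_zero, zero_add]

theorem eq_or_eq_add_of_inv_add_inv [CharP F 2] {x y a : F} (ha : a ≠ 0) (hx : x ≠ 0)
    (hxa : x + a ≠ 0) (hy : y ≠ 0) (hya : y + a ≠ 0)
    (h : y⁻¹ + (y + a)⁻¹ = x⁻¹ + (x + a)⁻¹) : y = x ∨ y = x + a := by
  have h2 : (2 : F) = 0 := CharTwo.two_eq_zero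
  have h1 := (inv_add_inv_eq_iff hx hxa).mp rfl
  have h3 := (inv_add_inv_eq_iff hy hya).mp h
  have hb : x⁻¹ + (x + a)⁻¹ ≠ 0 := fun h0 => ha (by rw [h1, h0, zero_mul])
  have h4 : y * (y + a) = x * (x + a) := mul_left_cancel₀ hb (h3.symm.trans h1)
  have h5 : (y - x) * (y - (x + a)) = 0 := by
    linear_combination h4 + (x * (x + a) - y * (x + a)) * h2
  rcases mul_eq_zero.mp h5 with h | h
  · exact Or.inl (sub_eq_zero.mp h)
  · exact Or.inr (sub_eq_zero.mp h)

/-- The number of solutions outside `S` of `x⁻¹ + (x + a)⁻¹ = b`. -/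
def invCount (S : Finset F) (a b : F) : ℕ :=
  (Sᶜ.filter fun x : F => x⁻¹ + (x + a)⁻¹ = b).card

theorem invCount_eq_two [CharP F 2] {S : Finset F} {a x : F} (ha : a ≠ 0) (h0 : (0 : F) ∈ S)
    (hS : ∀ y, y + a ∈ S → y ∈ S) (hx : x ∉ S) : invCount S a (x⁻¹ + (x + a)⁻¹) = 2 := by
  have key : ∀ y, y ∉ S → y ≠ 0 ∧ y + a ≠ 0 := fun y hy =>
    ⟨fun h => hy (h ▸ h0), fun h => hy (hS y (h ▸ h0))⟩
  rw [← Finset.card_pair (add_self_ne ha x), invCount]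
  congr 1
  ext y
  simp only [mem_filter, mem_compl, mem_insert, mem_singleton]
  constructor
  · rintro ⟨hy, h⟩
    exact eq_or_eq_add_of_inv_add_inv ha (key x hx).1 (key x hx).2 (key y hy).1 (key y hy).2 h
  · rintro (rfl | rfl)
    · exact ⟨hx, rfl⟩
    · exact ⟨fun h => hx (hS x h), by rw [add_add_self, add_comm]⟩

theorem invCount_eq_zero_or_two [CharP F 2] {S : Finset F} {a : F} (ha : a ≠ 0)
    (h0 : (0 : F) ∈ S) (hS : ∀ y, y + a ∈ S → y ∈ S) (b : F) :
    invCount S a b = 0 ∨ invCount S a b = 2 := by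
  by_cases h : ∃ x, x ∉ S ∧ x⁻¹ + (x + a)⁻¹ = b
  · obtain ⟨x, hx, rfl⟩ := h
    exact Or.inr (invCount_eq_two ha h0 hS hx)
  · push Not at h
    left
    simpa [invCount, Finset.filter_eq_empty_iff] using h

theorem delta_inv [CharP F 2] {a : F} (ha : a ≠ 0) (b : F) :
    delta (fun x : F => x⁻¹) a b = (if b = a⁻¹ then 2 else 0) + invCount {0, a} a b := by
  rw [delta, invCount, Finset.card_filter, Finset.card_filter,
    ← Finset.sum_add_sum_compl ({0, a} : Finset F), Finset.sum_pair ha.symm]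
  by_cases h : b = a⁻¹
  · simp [h, CharTwo.add_self_eq_zero]
  · simp [h, Ne.symm h, CharTwo.add_self_eq_zero]

theorem delta_Fmod_one [CharP F 2] {a : F} (ha : a ≠ 0) (ha1 : a ≠ 1) (b : F) :
    delta (Fmod 1) a b = (if b = 1 + a⁻¹ then 2 else 0) + (if b = (a + 1)⁻¹ then 2 else 0)
      + invCount {0, a, 1, a + 1} a b := by
  have h11 : (1 : F) + 1 = 0 := CharTwo.add_self_eq_zero 1
  have haa : a + a = 0 := CharTwo.add_self_eq_zero a
  have ha' : a + 1 ≠ 0 := fun h => ha1 (by linear_combination h - h11)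
  have ha'' : 1 + a ≠ 0 := by rwa [add_comm]
  rw [delta, invCount, Finset.card_filter, Finset.card_filter,
    ← Finset.sum_add_sum_compl ({0, a, 1, a + 1} : Finset F)]
  congr 1
  · rw [Finset.sum_insert (by simp [ha.symm, ha'.symm]),
      Finset.sum_insert (by simp [ha1]), Finset.sum_pair (by simpa using ha)]
    have e : a + 1 + a = 1 := by rw [add_right_comm, haa, zero_add]
    simp only [Fmod, e, haa, zero_add, ha, ha1, ha', if_true, if_false, inv_one,
      one_ne_zero, add_eq_right, add_zero, add_comm (1 : F) a, add_comm a⁻¹ 1,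
      eq_comm (a := b)]
    by_cases h : 1 + a⁻¹ = b <;> by_cases h' : (a + 1)⁻¹ = b <;> simp [h, h']
  · refine Finset.sum_congr rfl fun x hx => ?_
    simp only [mem_compl, mem_insert, mem_singleton, not_or] at hx
    obtain ⟨h0, h1, h2, h3⟩ := hx
    have h4 : x + a ≠ 0 := fun h => h1 (by linear_combination h - haa)
    have h5 : x + a ≠ 1 := fun h => h3 (by linear_combination h - haa)
    simp [Fmod, h0, h2, h4, h5]

theorem delta_Fmod_one_one [CharP F 2] (b : F) :
    delta (Fmod (1 : F)) 1 b = delta (fun x : F => x⁻¹) 1 b := by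
  have h11 : (1 : F) + 1 = 0 := CharTwo.add_self_eq_zero 1
  unfold delta
  congr 2
  ext x
  by_cases h0 : x = 0
  · simp [h0, Fmod]
  · by_cases h1 : x = 1
    · simp [h1, Fmod, h11]
    · have : x + 1 ≠ 0 := fun h => h1 (by linear_combination h - h11)
      simp [Fmod, h0, h1, this]

theorem rowWeight_inv [CharP F 2] {ω : F} (hω : ω ^ 2 + ω + 1 = 0) {a : F} (ha : a ≠ 0) :
    rowWeight (fun x : F => x⁻¹) a = 8 := by
  have h2 : (2 : F) = 0 := CharTwo.two_eq_zero
  have h0 : (0 : F) ∈ ({0, a} : Finset F) := by simp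
  have hS : ∀ y : F, y + a ∈ ({0, a} : Finset F) → y ∈ ({0, a} : Finset F) := by
    intro y
    simp only [mem_insert, mem_singleton]
    rintro (h | h)
    · exact Or.inr (by linear_combination h - a * h2)
    · exact Or.inl (by linear_combination h)
  have hω0 : ω ≠ 0 := by rintro rfl; simp at hω
  have hω1 : ω ≠ 1 := by
    rintro rfl
    exact one_ne_zero (by linear_combination hω - h2 : (1 : F) = 0)
  have hω1' : ω + 1 ≠ 0 := fun h => hω1 (by linear_combination h - h2)
  have hsol : (a * ω)⁻¹ + (a * ω + a)⁻¹ = a⁻¹ := by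
    rw [inv_add_inv_eq_iff (mul_ne_zero ha hω0)
      (by rw [← mul_add_one]; exact mul_ne_zero ha hω1')]
    have : a⁻¹ * a = 1 := inv_mul_cancel₀ ha
    linear_combination (-(a * ω * (ω + 1))) * this - a * hω + a * h2
  have hcount : invCount {0, a} a a⁻¹ = 2 := by
    rw [← hsol]
    exact invCount_eq_two ha h0 hS (by simp [ha, hω0, hω1])
  rw [rowWeight, Finset.sum_eq_single a⁻¹]
  · rw [delta_inv ha, hcount]
    simp [weight]
  · intro b _ hb
    rw [delta_inv ha, if_neg hb]
    rcases invCount_eq_zero_or_two ha h0 hS b with h | h <;> simp [h, weight]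
  · simp

theorem not_twoToOne_of_rowWeight_ne_zero {G : F → F} {a : F} (h : rowWeight G a ≠ 0) :
    ¬ TwoToOne G a := by
  intro hG
  refine h (Finset.sum_eq_zero fun b _ => ?_)
  rcases hG b with h | h <;> simp [h, weight]

theorem rowWeight_Fmod_one [CharP F 2] {a : F} (ha : a ≠ 0) (ha1 : a ≠ 1) :
    rowWeight (Fmod 1) a = 4 * (invCount {0, a, 1, a + 1} a (1 + a⁻¹) : ℤ)
      + 4 * (invCount {0, a, 1, a + 1} a (a + 1)⁻¹ : ℤ)
      + if a ^ 2 + a + 1 = 0 then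
          (if invCount {0, a, 1, a + 1} a (1 + a⁻¹) = 0 then 8 else -1) else 0 := by
  have h2 : (2 : F) = 0 := CharTwo.two_eq_zero
  set S : Finset F := {0, a, 1, a + 1} with hSdef
  have h0 : (0 : F) ∈ S := by simp [hSdef]
  have hS : ∀ y : F, y + a ∈ S → y ∈ S := by
    intro y
    simp only [hSdef, mem_insert, mem_singleton]
    rintro (h | h | h | h)
    · exact Or.inr (Or.inl (by linear_combination h - a * h2))
    · exact Or.inl (by linear_combination h)
    · exact Or.inr (Or.inr (Or.inr (by linear_combination h - a * h2)))
    · exact Or.inr (Or.inr (Or.inl (by linear_combination h)))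
  have ha' : a + 1 ≠ 0 := fun h => ha1 (by linear_combination h - h2)
  have hiff : 1 + a⁻¹ = (a + 1)⁻¹ ↔ a ^ 2 + a + 1 = 0 := by
    rw [← mul_left_inj' (mul_ne_zero ha ha')]
    have e1 : a⁻¹ * a = 1 := inv_mul_cancel₀ ha
    have e2 : (a + 1)⁻¹ * (a + 1) = 1 := inv_mul_cancel₀ ha'
    constructor <;> intro h
    · linear_combination h - (a + 1) * e1 + a * e2
    · linear_combination h + (a + 1) * e1 - a * e2
  have hc := invCount_eq_zero_or_two ha h0 hS
  simp only [rowWeight, delta_Fmod_one ha ha1, ← hSdef]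
  by_cases hb : 1 + a⁻¹ = (a + 1)⁻¹
  · rw [if_pos (hiff.mp hb), ← hb, Finset.sum_eq_single (1 + a⁻¹)]
    · rcases hc (1 + a⁻¹) with h | h <;> simp [h, weight]
    · intro b _ hb
      rcases hc b with h | h <;> simp [h, weight, hb]
    · simp
  · rw [if_neg (fun h => hb (hiff.mpr h)), Fintype.sum_eq_add _ _ hb]
    · rcases hc (1 + a⁻¹) with h | h <;> rcases hc (a + 1)⁻¹ with h' | h' <;>
        simp [h, h', weight, hb, Ne.symm hb]
    · rintro b ⟨hb, hb'⟩
      rcases hc b with h | h <;> simp [h, weight, hb, hb']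

theorem sq_add_self_ne [CharP F 2] {ω t : F} (hω : ω ^ 2 + ω + 1 = 0)
    (ht : t ∈ ({0, 1, ω, ω + 1} : Finset F)ᶜ) : t ^ 2 + t ≠ 0 ∧ t ^ 2 + t ≠ 1 := by
  have h2 : (2 : F) = 0 := CharTwo.two_eq_zero
  simp only [mem_compl, mem_insert, mem_singleton, not_or] at ht
  obtain ⟨h0, h1, h3, h4⟩ := ht
  constructor <;> intro h
  · have : t * (t - 1) = 0 := by linear_combination h - t * h2
    rcases mul_eq_zero.mp this with h | h
    · exact h0 h
    · exact h1 (sub_eq_zero.mp h)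
  · have : (t - ω) * (t - (ω + 1)) = 0 := by
      linear_combination h + hω - (t + t * ω) * h2
    rcases mul_eq_zero.mp this with h | h
    · exact h3 (sub_eq_zero.mp h)
    · exact h4 (sub_eq_zero.mp h)

theorem mem_compl_of_sq_add_self_ne [CharP F 2] {ω t : F} (hω : ω ^ 2 + ω + 1 = 0)
    (h0 : t ^ 2 + t ≠ 0) (h1 : t ^ 2 + t ≠ 1) : t ∈ ({0, 1, ω, ω + 1} : Finset F)ᶜ := by
  have h2 : (2 : F) = 0 := CharTwo.two_eq_zero
  simp only [mem_compl, mem_insert, mem_singleton]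
  rintro (rfl | rfl | rfl | rfl)
  · exact h0 (by ring)
  · exact h0 (by linear_combination h2)
  · exact h1 (by linear_combination hω - h2)
  · exact h1 (by linear_combination hω + ω * h2)

theorem invCount_eq_card_filter [CharP F 2] {ω a b : F} (hω : ω ^ 2 + ω + 1 = 0) (ha : a ≠ 0)
    (hb : a * b ≠ 1) (hb' : (a + 1) * b ≠ a) : invCount {0, a, 1, a + 1} a b =
      (({0, 1, ω, ω + 1} : Finset F)ᶜ.filter fun t => (t ^ 2 + t) * (a * b) = 1).card := by
  have h2 : (2 : F) = 0 := CharTwo.two_eq_zero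
  symm
  refine Finset.card_nbij' (fun t => a * t) (fun x => a⁻¹ * x) ?_ ?_ ?_ ?_
  · intro t ht
    obtain ⟨ht, h⟩ := mem_filter.mp (mem_coe.mp ht)
    refine mem_coe.mpr (mem_filter.mpr ?_)
    obtain ⟨hu0, hu1⟩ := sq_add_self_ne hω ht
    have ht0 : t ≠ 0 := by rintro rfl; simp at hu0
    have ht1 : t + 1 ≠ 0 := fun h => hu0 (by linear_combination t * h)
    have hat : a * t + a ≠ 0 := by rw [← mul_add_one]; exact mul_ne_zero ha ht1
    refine ⟨?_, ?_⟩
    · simp only [mem_compl, mem_insert, mem_singleton]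
      rintro (h' | h' | h' | h')
      · exact mul_ne_zero ha ht0 h'
      · exact hat (by linear_combination h' + a * h2)
      · exact hb' (by linear_combination a * h - b * (a * t + 1 + a) * h')
      · exact hb' (by linear_combination a * h - b * (a * t + 1 + a + a) * h'
          - (b * a * (a + 1)) * h2)
    · rw [inv_add_inv_eq_iff (mul_ne_zero ha ht0) hat]
      linear_combination (-a) * h
  · intro x hx
    obtain ⟨t, rfl⟩ : ∃ t, x = a * t := ⟨a⁻¹ * x, by simp [ha]⟩
    obtain ⟨hx, h⟩ := mem_filter.mp (mem_coe.mp hx)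
    refine mem_coe.mpr (mem_filter.mpr ?_)
    simp only [inv_mul_cancel_left₀ ha]
    simp only [mem_compl, mem_insert, mem_singleton, not_or] at hx
    obtain ⟨h0, h1, -, -⟩ := hx
    have hat : a * t + a ≠ 0 := fun h => h1 (by linear_combination h - a * h2)
    rw [inv_add_inv_eq_iff h0 hat] at h
    have h' : (t ^ 2 + t) * (a * b) = 1 := mul_left_cancel₀ ha (by linear_combination -h)
    refine ⟨mem_compl_of_sq_add_self_ne hω ?_ ?_, h'⟩
    · intro h0
      simp [h0] at h'
    · intro h1
      exact hb (by rw [← h', h1, one_mul])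
  · intro t _
    simp [ha]
  · intro x _
    simp [ha]

theorem invCount_one_add_inv [CharP F 2] {ω a : F} (hω : ω ^ 2 + ω + 1 = 0) (ha : a ≠ 0) :
    invCount {0, a, 1, a + 1} a (1 + a⁻¹) =
      (({0, 1, ω, ω + 1} : Finset F)ᶜ.filter fun t => (t ^ 2 + t) * (a + 1) = 1).card := by
  have h2 : (2 : F) = 0 := CharTwo.two_eq_zero
  have e : a * (1 + a⁻¹) = a + 1 := by rw [mul_add, mul_inv_cancel₀ ha, mul_one]
  rw [invCount_eq_card_filter hω ha, e]
  · simpa [e] using ha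
  · intro h
    refine one_ne_zero (α := F) ?_
    linear_combination a * h - (a + 1) * e - a * h2

theorem invCount_add_one_inv [CharP F 2] {ω a : F} (hω : ω ^ 2 + ω + 1 = 0) (ha : a ≠ 0)
    (ha1 : a ≠ 1) : invCount {0, a, 1, a + 1} a (a + 1)⁻¹ =
      (({0, 1, ω, ω + 1} : Finset F)ᶜ.filter fun t => (t ^ 2 + t + 1) * a = 1).card := by
  have h2 : (2 : F) = 0 := CharTwo.two_eq_zero
  have ha' : a + 1 ≠ 0 := fun h => ha1 (by linear_combination h - h2)
  have e : (a + 1) * (a + 1)⁻¹ = 1 := mul_inv_cancel₀ ha'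
  rw [invCount_eq_card_filter hω ha]
  · congr 1
    refine Finset.filter_congr fun t _ => ?_
    rw [← mul_assoc, ← div_eq_mul_inv, div_eq_one_iff_eq ha']
    constructor <;> intro h
    · linear_combination h + a * h2
    · linear_combination h - a * h2
  · rw [← div_eq_mul_inv, Ne, div_eq_one_iff_eq ha']
    simp
  · rw [e]
    exact ha1.symm

theorem card_compl [CharP F 2] {ω : F} (hω : ω ^ 2 + ω + 1 = 0) :
    ((({0, 1, ω, ω + 1} : Finset F)ᶜ).card : ℤ) = Fintype.card F - 4 := by
  have h2 : (2 : F) = 0 := CharTwo.two_eq_zero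
  have h0 : ω ≠ 0 := by rintro rfl; simp at hω
  have h1 : ω ≠ 1 := by
    rintro rfl
    exact one_ne_zero (by linear_combination hω - h2 : (1 : F) = 0)
  have h3 : ω + 1 ≠ 0 := fun h => h1 (by linear_combination h - h2)
  have hc : ({0, 1, ω, ω + 1} : Finset F).card = 4 := by
    rw [Finset.card_insert_of_notMem (by simp [h0.symm, h3.symm]),
      Finset.card_insert_of_notMem (by simp [h0, h1.symm]), Finset.card_pair (by simp)]
  have := Finset.card_add_card_compl ({0, 1, ω, ω + 1} : Finset F)
  omega

theorem sum_invCount_one_add_inv [CharP F 2] {ω : F} (hω : ω ^ 2 + ω + 1 = 0) :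
    ∑ a ∈ (univ.erase (0 : F)).erase 1, (invCount {0, a, 1, a + 1} a (1 + a⁻¹) : ℤ)
      = Fintype.card F - 4 := by
  have h2 : (2 : F) = 0 := CharTwo.two_eq_zero
  rw [← card_compl hω, ← Nat.cast_sum]
  congr 1
  rw [Finset.sum_congr rfl fun a ha => invCount_one_add_inv hω
    (Finset.ne_of_mem_erase (Finset.mem_of_mem_erase ha))]
  refine (Finset.sum_card_bipartiteAbove_eq_sum_card_bipartiteBelow _).trans ?_
  rw [Finset.card_eq_sum_ones]
  refine Finset.sum_congr rfl fun t ht => ?_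
  obtain ⟨hu0, hu1⟩ := sq_add_self_ne hω ht
  have e : (t ^ 2 + t) * (t ^ 2 + t)⁻¹ = 1 := mul_inv_cancel₀ hu0
  refine Finset.card_eq_one.mpr ⟨(t ^ 2 + t)⁻¹ + 1, ?_⟩
  ext a
  simp only [Finset.bipartiteBelow, mem_filter, mem_erase, mem_univ, and_true, mem_singleton]
  constructor
  · rintro ⟨-, h⟩
    exact mul_left_cancel₀ hu0 (by linear_combination h - e - (t ^ 2 + t) * h2)
  · rintro rfl
    refine ⟨⟨?_, ?_⟩, ?_⟩
    · simpa using hu0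
    · intro h
      exact hu1 (by linear_combination e - (t ^ 2 + t) * h + (t ^ 2 + t) * h2)
    · linear_combination e + (t ^ 2 + t) * h2

theorem sum_invCount_add_one_inv [CharP F 2] {ω : F} (hω : ω ^ 2 + ω + 1 = 0) :
    ∑ a ∈ (univ.erase (0 : F)).erase 1, (invCount {0, a, 1, a + 1} a (a + 1)⁻¹ : ℤ)
      = Fintype.card F - 4 := by
  have h2 : (2 : F) = 0 := CharTwo.two_eq_zero
  rw [← card_compl hω, ← Nat.cast_sum]
  congr 1
  rw [Finset.sum_congr rfl fun a ha => invCount_add_one_inv hω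
    (Finset.ne_of_mem_erase (Finset.mem_of_mem_erase ha)) (Finset.ne_of_mem_erase ha)]
  refine (Finset.sum_card_bipartiteAbove_eq_sum_card_bipartiteBelow _).trans ?_
  rw [Finset.card_eq_sum_ones]
  refine Finset.sum_congr rfl fun t ht => ?_
  obtain ⟨hu0, hu1⟩ := sq_add_self_ne hω ht
  have hu : t ^ 2 + t + 1 ≠ 0 := fun h => hu1 (by linear_combination h - h2)
  refine Finset.card_eq_one.mpr ⟨(t ^ 2 + t + 1)⁻¹, ?_⟩
  ext a
  simp only [Finset.bipartiteBelow, mem_filter, mem_erase, mem_univ, and_true, mem_singleton]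
  constructor
  · rintro ⟨-, h⟩
    exact eq_inv_of_mul_eq_one_right h
  · rintro rfl
    exact ⟨⟨by simpa using hu0, inv_ne_zero hu⟩, mul_inv_cancel₀ hu⟩

theorem sum_rowWeight_Fmod_one [CharP F 2] {ω : F} (hω : ω ^ 2 + ω + 1 = 0) {c : ℤ}
    (hc : ∀ a : F, a ^ 2 + a + 1 = 0 →
      (if invCount {0, a, 1, a + 1} a (1 + a⁻¹) = 0 then (8 : ℤ) else -1) = c) :
    ∑ a ∈ univ.erase (0 : F), rowWeight (Fmod (1 : F)) a
      = 8 * (Fintype.card F : ℤ) - 24 + 2 * c := by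
  have h2 : (2 : F) = 0 := CharTwo.two_eq_zero
  have h1 : rowWeight (Fmod (1 : F)) 1 = 8 := by
    rw [← rowWeight_inv hω one_ne_zero]
    simp only [rowWeight, delta_Fmod_one_one]
  have hroots : ((univ.erase (0 : F)).erase 1).filter (fun a => a ^ 2 + a + 1 = 0)
      = {ω, ω + 1} := by
    ext a
    simp only [mem_filter, mem_erase, mem_univ, and_true, mem_insert, mem_singleton]
    constructor
    · rintro ⟨-, h⟩
      have : (a - ω) * (a - (ω + 1)) = 0 := by
        linear_combination h + hω - (a + a * ω + 1) * h2
      rcases mul_eq_zero.mp this with h | h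
      · exact Or.inl (sub_eq_zero.mp h)
      · exact Or.inr (sub_eq_zero.mp h)
    · intro h
      have ha : a ^ 2 + a + 1 = 0 := by
        rcases h with rfl | rfl
        · exact hω
        · linear_combination hω + (ω + 1) * h2
      refine ⟨⟨?_, ?_⟩, ha⟩
      · rintro rfl
        exact one_ne_zero (by linear_combination ha - h2 : (1 : F) = 0)
      · rintro rfl
        simp at ha
  have hlast : (∑ a ∈ (univ.erase (0 : F)).erase 1, if a ^ 2 + a + 1 = 0 then
      (if invCount {0, a, 1, a + 1} a (1 + a⁻¹) = 0 then (8 : ℤ) else -1) else 0) = 2 * c := by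
    rw [← Finset.sum_filter, Finset.sum_congr rfl fun a ha => hc a (mem_filter.mp ha).2,
      hroots, Finset.sum_const, Finset.card_pair (by simp)]
    simp
  rw [← Finset.add_sum_erase _ _ (show (1 : F) ∈ univ.erase 0 by simp), h1,
    Finset.sum_congr rfl fun a ha => rowWeight_Fmod_one
      (Finset.ne_of_mem_erase (Finset.mem_of_mem_erase ha)) (Finset.ne_of_mem_erase ha),
    Finset.sum_add_distrib, Finset.sum_add_distrib, ← Finset.mul_sum, ← Finset.mul_sum,
    sum_invCount_one_add_inv hω, sum_invCount_add_one_inv hω, hlast]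
  ring

theorem invCount_eq_zero_iff [CharP F 2] {a : F} (ha : a ^ 2 + a + 1 = 0) :
    invCount {0, a, 1, a + 1} a (1 + a⁻¹) = 0 ↔ ∀ t : F, t ^ 2 + t ≠ a := by
  have h2 : (2 : F) = 0 := CharTwo.two_eq_zero
  have h0 : a ≠ 0 := by rintro rfl; simp at ha
  have h1 : a ≠ 1 := by
    rintro rfl
    exact one_ne_zero (by linear_combination ha - h2 : (1 : F) = 0)
  have h3 : a + 1 ≠ 0 := fun h => h1 (by linear_combination h - h2)
  rw [invCount_one_add_inv ha h0, Finset.card_eq_zero, Finset.filter_eq_empty_iff]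
  constructor
  · rintro h t rfl
    exact h (mem_compl_of_sq_add_self_ne ha h0 h1) (by linear_combination ha - h2)
  · intro h t _ ht
    exact h t (mul_right_cancel₀ h3 (by linear_combination ht - ha + h2))

theorem exists_orderOf_eq_of_dvd {p : ℕ} [Fact p.Prime] (h : p ∣ Fintype.card F - 1) :
    ∃ x : F, orderOf x = p := by
  rw [← Fintype.card_units] at h
  obtain ⟨x, hx⟩ := exists_prime_orderOf_dvd_card p h
  exact ⟨x, by rw [orderOf_units, hx]⟩

theorem exists_sq_add_self_add_one (h : 3 ∣ Fintype.card F - 1) :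
    ∃ ω : F, ω ^ 2 + ω + 1 = 0 := by
  have : Fact (Nat.Prime 3) := ⟨by norm_num⟩
  obtain ⟨x, hx⟩ := exists_orderOf_eq_of_dvd h
  have h1 : x - 1 ≠ 0 := by
    intro h
    rw [sub_eq_zero.mp h, orderOf_one] at hx
    omega
  have h3 : x ^ 3 = 1 := hx ▸ pow_orderOf_eq_one x
  exact ⟨x, mul_left_cancel₀ h1 (by linear_combination h3)⟩

theorem exists_sq_add_self_eq [CharP F 2] (h : 5 ∣ Fintype.card F - 1) {a : F}
    (ha : a ^ 2 + a + 1 = 0) : ∃ t : F, t ^ 2 + t = a := by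
  have h2 : (2 : F) = 0 := CharTwo.two_eq_zero
  have : Fact (Nat.Prime 5) := ⟨by norm_num⟩
  obtain ⟨x, hx⟩ := exists_orderOf_eq_of_dvd h
  have h1 : x - 1 ≠ 0 := by
    intro h
    rw [sub_eq_zero.mp h, orderOf_one] at hx
    omega
  have h5 : x ^ 5 = 1 := hx ▸ pow_orderOf_eq_one x
  have hx : x ^ 4 + x ^ 3 + x ^ 2 + x + 1 = 0 := mul_left_cancel₀ h1 (by linear_combination h5)
  have key : (x + x ^ 4 - a) * (x + x ^ 4 - (a + 1)) = 0 := by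
    linear_combination (x ^ 3 + 2) * h5 + hx + ha - (x + x ^ 4 + a * x + a * x ^ 4) * h2
  have ha3 : a ^ 3 = 1 := by linear_combination (a - 1) * ha
  rcases mul_eq_zero.mp key with hs | hs
  · have hxa : x ^ 2 + x * a + 1 = 0 := by
      linear_combination (-x) * hs + h5 + (x ^ 2 + 1) * h2
    exact ⟨x * a ^ 2, by linear_combination a * hxa + x ^ 2 * a * ha3 - a * h2⟩
  · have hxa : x ^ 2 + x * (a + 1) + 1 = 0 := by
      linear_combination (-x) * hs + h5 + (x ^ 2 + 1) * h2
    have h0 : (x * a) ^ 2 + x * a = a + 1 := by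
      linear_combination a ^ 2 * hxa - x * ha3 - x * ha + x * a * h2 - ha
    exact ⟨(x * a) ^ 2, by
      linear_combination ((x * a) ^ 2 + x * a + a + 1) * h0 - (x * a) ^ 3 * h2 + ha⟩

theorem sq_add_self_ne_of_card [CharP F 2] {m : ℕ} (h : Fintype.card F = 2 ^ (4 * m + 2))
    {a : F} (ha : a ^ 2 + a + 1 = 0) (t : F) : t ^ 2 + t ≠ a := by
  have h2 : (2 : F) = 0 := CharTwo.two_eq_zero
  rintro rfl
  have h4 : t ^ 4 = t + 1 := by linear_combination ha - (t ^ 3 + t ^ 2 + t + 1) * h2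
  have h16 : t ^ 16 = t := by
    linear_combination (t ^ 12 + t ^ 8 * (t + 1) + t ^ 4 * (t + 1) ^ 2 + (t + 1) ^ 3) * h4 + h4
      + (2 * t ^ 3 + 3 * t ^ 2 + 2 * t + 1) * h2
  have hm : ∀ m : ℕ, t ^ 16 ^ m = t := by
    intro m
    induction m with
    | zero => simp
    | succ m ih => rw [pow_succ, pow_mul, ih, h16]
  have hq := FiniteField.pow_card t
  rw [h, pow_add, pow_mul, pow_mul, show (2 : ℕ) ^ 4 = 16 by norm_num, hm,
    show (2 : ℕ) ^ 2 = 4 by norm_num, h4] at hq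
  simp at hq

theorem APNdef_inv [CharP F 2] {ω : F} (hω : ω ^ 2 + ω + 1 = 0) :
    APNdef (fun x : F => x⁻¹) = 9 * ((Fintype.card F : ℤ) - 1) := by
  have hR : RSpec (fun x : F => x⁻¹) = ∅ := by
    refine Finset.filter_eq_empty_iff.mpr fun a ha => not_twoToOne_of_rowWeight_ne_zero ?_
    rw [rowWeight_inv hω (Finset.ne_of_mem_erase ha)]
    norm_num
  have hq : 1 ≤ Fintype.card F := Fintype.card_pos
  rw [APNdef_eq, hR, Finset.sum_congr rfl fun a ha =>
    rowWeight_inv hω (Finset.ne_of_mem_erase ha), Finset.sum_const,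
    Finset.card_erase_of_mem (mem_univ _), Finset.card_univ, nsmul_eq_mul, Nat.cast_sub hq]
  simp only [Nat.cast_one, Finset.card_empty, Nat.cast_zero]
  ring

theorem pow_card_sub_two (h : 2 < Fintype.card F) (x : F) :
    x ^ (Fintype.card F - 2) = x⁻¹ := by
  by_cases hx : x = 0
  · rw [hx, inv_zero, zero_pow (by omega)]
  · refine eq_inv_of_mul_eq_one_left ?_
    rw [← pow_succ, show Fintype.card F - 2 + 1 = Fintype.card F - 1 by omega,
      FiniteField.pow_card_sub_one_eq_one x hx]

/-- the APN-defect of `F_{0,α}` for even `n ≥ 4`, in terms of the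
APN-defect of the inverse function. -/
theorem stmt_14 (n : ℕ) (hn : 4 ≤ n) (heven : Even n)
    [CharP F 2] (hcard : Fintype.card F = 2 ^ n)
    (α : F) (hα : α ≠ 0) (k : ℕ)
    (hk : k = (RSpec (Fmod α)).card) :
    (n % 4 = 2 →
      APNdef (Fmod α) = 9 * ((2 : ℤ) ^ n - 1) - (k : ℤ) ∧
      APNdef (Fmod α) = APNdef (fun x : F => x ^ (2 ^ n - 2)) - (k : ℤ)) ∧
    (n % 4 = 0 →
      APNdef (Fmod α) = 9 * ((2 : ℤ) ^ n - 1) - (k : ℤ) - 18 ∧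
      APNdef (Fmod α) = APNdef (fun x : F => x ^ (2 ^ n - 2)) - (k : ℤ) - 18) := by
  have h3 : 3 ∣ Fintype.card F - 1 := by
    obtain ⟨m, rfl⟩ := heven
    rw [hcard, ← two_mul, pow_mul]
    simpa using Nat.sub_dvd_pow_sub_pow 4 1 m
  obtain ⟨ω, hω⟩ := exists_sq_add_self_add_one h3
  have hq : 2 < Fintype.card F := by
    rw [hcard]
    calc 2 = 2 ^ 1 := by norm_num
      _ < 2 ^ n := Nat.pow_lt_pow_right (by norm_num) (by omega)
  have hinv : APNdef (fun x : F => x ^ (2 ^ n - 2)) = 9 * ((2 : ℤ) ^ n - 1) := by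
    have hcast : (Fintype.card F : ℤ) = 2 ^ n := by rw [hcard]; push_cast; rfl
    rw [← hcard, ← hcast, ← APNdef_inv hω]
    simp only [pow_card_sub_two hq]
  have hmod {c : ℤ} (hc : ∀ a : F, a ^ 2 + a + 1 = 0 →
      (if invCount {0, a, 1, a + 1} a (1 + a⁻¹) = 0 then (8 : ℤ) else -1) = c) :
      APNdef (Fmod α) = 9 * ((2 : ℤ) ^ n - 1) - k - 16 + 2 * c := by
    rw [APNdef_eq, sum_rowWeight_Fmod hα, sum_rowWeight_Fmod_one hω hc, ← hk, hcard]
    push_cast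
    ring
  rw [hinv]
  constructor <;> intro hn4
  · have h := hmod (c := 8) fun a ha => if_pos ((invCount_eq_zero_iff ha).mpr
      (sq_add_self_ne_of_card (m := n / 4) (by rw [hcard]; congr 1; omega) ha))
    constructor <;> linarith
  · have h5 : 5 ∣ Fintype.card F - 1 := by
      rw [hcard, show n = 4 * (n / 4) by omega, pow_mul]
      exact dvd_trans (by norm_num) (Nat.sub_dvd_pow_sub_pow 16 1 (n / 4) |>.trans (by simp))
    have h := hmod (c := -1) fun a ha => if_neg fun h0 => by
      obtain ⟨t, ht⟩ := exists_sq_add_self_eq h5 ha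
      exact (invCount_eq_zero_iff ha).mp h0 t ht
    constructor <;> linarith


end APNPaper
end

section
/- Let q = 2^n, α ∈ 𝔽_q^*, and for even n let ω be a fixed element of 𝔽_4 \ 𝔽_2 regarded as an element of 𝔽_q. Set k = |R-Spec_q(F_{0,α})|, ℓ = |{a ∈ 𝔽_q \ {0, α} : Tr(α/(a+α)) = 0 and Tr(α/a) = 1}|, and s = |{a ∈ 𝔽_q \ {0, α, αω, αω²} : Tr(α/(a+α)) = Tr(α/a) = 0}|. Then the number of vanishing flats of F_{0,α} satisfies: |VF_{F_{0,α}}| = (q + ℓ − k − 1)/3 when n is odd (n ≥ 3); |VF_{F_{0,α}}| = (q + s − k − 1)/3 when n ≡ 2 (mod 4); and |VF_{F_{0,α}}| = (q + s − k + 3)/3 when n ≡ 0 (mod 4) (n ≥ 4). -/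
namespace APNPaper

open Finset

variable {F : Type*} [Field F] [Fintype F] [DecidableEq F]

theorem Tr_add {K : Type*} [Field K] [CharP K 2] (n : ℕ) (x y : K) : Tr n (x + y) = Tr n x + Tr n y := by
  simp [Tr, add_pow_char_pow, Finset.sum_add_distrib]

theorem Tr_sq_add_self {K : Type*} [Field K] [Fintype K] [CharP K 2] {n : ℕ}
    (hcard : Fintype.card K = 2 ^ n) (x : K) :
    Tr n (x ^ 2 + x) = 0 := by
  rw [Tr_add]
  have hsq : Tr n (x ^ 2) + x = Tr n x + x := by
    have h : Tr n (x ^ 2) = ∑ i ∈ Finset.range n, x ^ 2 ^ (i + 1) := by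
      simp only [Tr, pow_succ' 2, pow_mul]
    have h' := Finset.sum_range_succ' (fun i => x ^ 2 ^ i) n
    rw [Finset.sum_range_succ, ← hcard, FiniteField.pow_card] at h'
    rw [h, Tr, h']
    simp
  rw [add_right_cancel hsq, CharTwo.add_self_eq_zero]

theorem card_Tr_eq_zero_le [CharP F 2] {n : ℕ} (hn : 0 < n) :
    (univ.filter fun z : F => Tr n z = 0).card ≤ 2 ^ (n - 1) := by
  obtain ⟨m, rfl⟩ : ∃ m, n = m + 1 := ⟨n - 1, by omega⟩
  let p : Polynomial F := ∑ i ∈ Finset.range m, Polynomial.X ^ 2 ^ i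
  have hp : p.degree < ((2 ^ m : ℕ) : WithBot ℕ) := by
    refine (Polynomial.degree_sum_le _ _).trans_lt ?_
    rw [Finset.sup_lt_iff (by exact WithBot.bot_lt_coe _)]
    intro i hi
    rw [Polynomial.degree_X_pow]
    exact_mod_cast Nat.pow_lt_pow_right one_lt_two (Finset.mem_range.mp hi)
  have hmon : (Polynomial.X ^ 2 ^ m + p).Monic := Polynomial.monic_X_pow_add hp
  have hdeg : (Polynomial.X ^ 2 ^ m + p).natDegree = 2 ^ m := by
    apply Polynomial.natDegree_eq_of_degree_eq_some
    rw [Polynomial.degree_add_eq_left_of_degree_lt] 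
    · simp
    · simpa using hp
  calc _ ≤ (Polynomial.X ^ 2 ^ m + p).roots.toFinset.card := by
        refine Finset.card_le_card fun z hz => ?_
        simp only [mem_filter, mem_univ, true_and, Tr, Finset.sum_range_succ] at hz
        rw [add_comm] at hz
        simpa [hmon.ne_zero, p, Polynomial.eval_finsetSum] using hz
    _ ≤ 2 ^ m := (Multiset.toFinset_card_le _).trans ((Polynomial.card_roots' _).trans hdeg.le)

theorem exists_sq_add_self_iff [CharP F 2] {n : ℕ} (hn : 0 < n)
    (hcard : Fintype.card F = 2 ^ n) (c : F) : (∃ y : F, y ^ 2 + y = c) ↔ Tr n c = 0 := by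
  have hsub : (univ.image fun y : F => y ^ 2 + y) ⊆ univ.filter fun z : F => Tr n z = 0 := by
    intro z hz
    obtain ⟨y, -, rfl⟩ := Finset.mem_image.mp hz
    simp [Tr_sq_add_self hcard]
  have hle : (univ : Finset F).card ≤ 2 * (univ.image fun y : F => y ^ 2 + y).card := by
    refine Finset.card_le_mul_card_image _ _ fun b hb => ?_
    obtain ⟨y, -, rfl⟩ := Finset.mem_image.mp hb
    refine (Finset.card_le_card (t := {y, y + 1}) fun z hz => ?_).trans Finset.card_le_two
    have h2 : (2 : F) = 0 := CharTwo.two_eq_zero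
    have : (z - y) * (z - (y + 1)) = 0 := by
      simp only [mem_filter, mem_univ, true_and] at hz
      linear_combination hz + (y ^ 2 + y - z * y - z) * h2
    rcases mul_eq_zero.mp this with h | h <;> simp [sub_eq_zero.mp h]
  rw [Finset.card_univ, hcard] at hle
  have h2n : 2 ^ n = 2 * 2 ^ (n - 1) := by rw [← pow_succ']; congr; omega
  have heq := Finset.eq_of_subset_of_card_le hsub
    ((card_Tr_eq_zero_le hn).trans (by omega))
  rw [Finset.ext_iff] at heq
  simpa using heq c

theorem card_sq_add_mul_eq [CharP F 2] {n : ℕ} (hn : 0 < n)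
    (hcard : Fintype.card F = 2 ^ n) {a : F} (ha : a ≠ 0) (t : F) :
    (univ.filter fun x : F => x ^ 2 + a * x = t).card = if Tr n (t / a ^ 2) = 0 then 2 else 0 := by
  have h2 : (2 : F) = 0 := CharTwo.two_eq_zero
  split_ifs with h
  · obtain ⟨y, hy⟩ := (exists_sq_add_self_iff hn hcard _).mpr h
    rw [eq_div_iff (pow_ne_zero 2 ha)] at hy
    have : (univ.filter fun x : F => x ^ 2 + a * x = t) = {a * y, a * y + a} := by
      ext x
      simp only [mem_filter, mem_univ, true_and, mem_insert, mem_singleton]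
      constructor
      · intro hx
        have : (x - a * y) * (x - (a * y + a)) = 0 := by
          linear_combination hx - hy + (a ^ 2 * y ^ 2 + a ^ 2 * y - a * x * y - a * x) * h2
        rcases mul_eq_zero.mp this with h | h <;> simp [sub_eq_zero.mp h]
      · rintro (rfl | rfl)
        · linear_combination hy
        · linear_combination hy + (a ^ 2 * y + a ^ 2) * h2
    rw [this, Finset.card_pair (by simpa using ha)]
  · rw [Finset.card_eq_zero, Finset.filter_eq_empty_iff]
    intro x _ hx
    refine h ((exists_sq_add_self_iff hn hcard _).mp ⟨x / a, ?_⟩)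
    field_simp
    linear_combination hx

/-- The number of ordered pairs `(x, z)` with `D_aG(x) = D_aG(z)` and `z ∉ {x, x + a}`. -/
def collisions (G : F → F) (a : F) : ℕ := ∑ b : F, delta G a b * (delta G a b - 2)

theorem twoToOne_iff_collisions_eq_zero [CharP F 2] (G : F → F) {a : F} (ha : a ≠ 0) :
    TwoToOne G a ↔ collisions G a = 0 := by
  simp only [TwoToOne, collisions, Finset.sum_eq_zero_iff, mem_univ, true_imp_iff]
  refine forall_congr' fun b => ?_
  have := delta_ne_one G ha b
  rw [Nat.mul_eq_zero]
  omega

theorem card_colliding_pairs [CharP F 2] (G : F → F) {a : F} (ha : a ≠ 0) :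
    (univ.filter fun p : (_ : F) × F => p.2 ≠ p.1 ∧ p.2 ≠ p.1 + a ∧
      G p.1 + G (p.1 + a) = G p.2 + G (p.2 + a)).card = collisions G a := by
  rw [Finset.card_eq_sum_card_fiberwise (t := univ)
    (f := fun p : (_ : F) × F => G p.1 + G (p.1 + a)) (by simp)]
  refine Finset.sum_congr rfl fun b _ => ?_
  set S := univ.filter fun x : F => G x + G (x + a) = b with hS
  have : (((univ.filter fun p : (_ : F) × F => p.2 ≠ p.1 ∧ p.2 ≠ p.1 + a ∧
      G p.1 + G (p.1 + a) = G p.2 + G (p.2 + a))).filter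
      fun p => G p.1 + G (p.1 + a) = b) = S.sigma fun x => (S.erase x).erase (x + a) := by
    ext ⟨x, z⟩
    simp only [mem_filter, mem_univ, true_and, mem_sigma, mem_erase, hS]
    constructor
    · rintro ⟨⟨h1, h2, h3⟩, h4⟩
      exact ⟨h4, h2, h1, h3 ▸ h4⟩
    · rintro ⟨h4, h2, h1, h3⟩
      exact ⟨⟨h1, h2, h4.trans h3.symm⟩, h4⟩
  rw [this, Finset.card_sigma, Finset.sum_congr rfl (g := fun _ => S.card - 2),
    Finset.sum_const, smul_eq_mul]
  · rfl
  · intro x hx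
    rw [Finset.card_erase_of_mem, Finset.card_erase_of_mem hx, Nat.sub_sub]
    rw [mem_erase]
    refine ⟨by simpa using ha, ?_⟩
    simp only [hS, mem_filter, mem_univ, true_and] at hx ⊢
    rw [add_assoc, CharTwo.add_self_eq_zero, add_zero, add_comm]
    exact hx

theorem twentyFour_mul_ncard_VF [CharP F 2] (G : F → F) :
    24 * (VF G).ncard = ∑ a ∈ univ.erase (0 : F), collisions G a := by
  classical
  let W : Finset ((_ : F) × (_ : F) × F) := univ.filter fun p =>
    p.1 ≠ p.2.1 ∧ p.1 ≠ p.2.2 ∧ p.2.1 ≠ p.2.2 ∧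
      G p.1 + G p.2.1 + G p.2.2 + G (p.1 + p.2.1 + p.2.2) = 0
  let f : ((_ : F) × (_ : F) × F) → Finset F := fun p =>
    {p.1, p.2.1, p.2.2, p.1 + p.2.1 + p.2.2}
  have h2 : (2 : F) = 0 := CharTwo.two_eq_zero
  have hVF : VF G = ↑(W.image f) := by
    ext S
    simp only [VF, Set.mem_ofPred_eq, coe_image, Set.mem_image, mem_coe, W, f, mem_filter,
      mem_univ, true_and]
    constructor
    · rintro ⟨x, y, z, h1, h2, h3, h4, rfl⟩
      exact ⟨⟨x, y, z⟩, ⟨h1, h2, h3, h4⟩, rfl⟩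
    · rintro ⟨⟨x, y, z⟩, ⟨h1, h2, h3, h4⟩, rfl⟩
      exact ⟨x, y, z, h1, h2, h3, h4, rfl⟩
  have hW : W.card = 24 * (VF G).ncard := by
    rw [hVF, Set.ncard_coe_finset, mul_comm, ← smul_eq_mul, ← Finset.sum_const,
      Finset.card_eq_sum_card_image f W]
    refine Finset.sum_congr rfl fun S hS => ?_
    obtain ⟨⟨x, y, z⟩, hp, rfl⟩ := Finset.mem_image.mp hS
    simp only [W, mem_filter, mem_univ, true_and] at hp
    obtain ⟨h1, h3, h4, h5⟩ := hp
    set S := f ⟨x, y, z⟩ with hSdef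
    have hcS : S.card = 4 := by
      have hx : x ≠ x + y + z := fun h => h4 (by linear_combination -h - z * h2)
      have hy : y ≠ x + y + z := fun h => h3 (by linear_combination -h - z * h2)
      have hz : z ≠ x + y + z := fun h => h1 (by linear_combination -h - y * h2)
      simp [hSdef, f, h1, h3, h4, hx, hy, hz]
    have hsum : ∀ g : F → F, ∑ t ∈ S, g t = g x + (g y + (g z + g (x + y + z))) := by
      intro g
      have hx : x ≠ x + y + z := fun h => h4 (by linear_combination -h - z * h2)
      have hy : y ≠ x + y + z := fun h => h3 (by linear_combination -h - z * h2)
      have hz : z ≠ x + y + z := fun h => h1 (by linear_combination -h - y * h2)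
      simp only [hSdef, f]
      rw [Finset.sum_insert, Finset.sum_insert, Finset.sum_insert, Finset.sum_singleton] <;>
        simp [h1, h3, h4, hx, hy, hz]
    have : W.filter (fun p => f p = S) =
        S.sigma fun x => (S.erase x).sigma fun y => (S.erase x).erase y := by
      ext ⟨u, v, w⟩
      simp only [mem_filter, mem_sigma, mem_erase, W, mem_univ, true_and]
      constructor
      · rintro ⟨⟨h1, h2, h3, h4⟩, h5⟩
        rw [← h5]
        simp [f, h1, h2, h3, Ne.symm h1, Ne.symm h2, Ne.symm h3]
      · rintro ⟨hu, ⟨hvu, hv⟩, hwv, hwu, hw⟩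
        have h3c : ({u, v, w} : Finset F).card = 3 := by
          simp [Ne.symm hvu, Ne.symm hwu, Ne.symm hwv]
        have hsub : ({u, v, w} : Finset F) ⊆ S := by
          simp [Finset.insert_subset_iff, hu, hv, hw]
        obtain ⟨t, ht, hS⟩ := Finset.exists_eq_insert_iff.mpr ⟨hsub, by rw [h3c, hcS]⟩
        have hsum' : ∀ g : F → F, ∑ r ∈ S, g r = g t + (g u + (g v + g w)) := by
          intro g
          rw [← hS, Finset.sum_insert ht, Finset.sum_insert (by simp [Ne.symm hvu, Ne.symm hwu]),
            Finset.sum_insert (by simp [Ne.symm hwv]), Finset.sum_singleton]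
        have ht : u + v + w = t := by
          have := (hsum fun r => r).symm.trans (hsum' fun r => r)
          linear_combination -this + (x + y + z - t) * h2
        refine ⟨⟨Ne.symm hvu, Ne.symm hwu, Ne.symm hwv, ?_⟩, ?_⟩
        · rw [ht]
          linear_combination h5 - (hsum G).symm.trans (hsum' G)
        · rw [← hS]
          ext r
          simp only [f, ht, mem_insert, mem_singleton]
          tauto
    rw [this, Finset.card_sigma, Finset.sum_congr rfl (g := fun _ => 6)]
    · simp [hcS]
    · intro u hu
      rw [Finset.card_sigma, Finset.sum_congr rfl (g := fun _ => 2)]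
      · simp [Finset.card_erase_of_mem hu, hcS]
      · intro v hv
        rw [Finset.card_erase_of_mem hv, Finset.card_erase_of_mem hu, hcS]
  rw [← hW, Finset.sum_congr rfl
    fun a ha => (card_colliding_pairs G (Finset.ne_of_mem_erase ha)).symm, ← Finset.card_sigma]
  refine Finset.card_bij' (fun p _ => ⟨p.1 + p.2.1, p.1, p.2.2⟩)
    (fun p _ => ⟨p.2.1, p.1 + p.2.1, p.2.2⟩) ?_ ?_ ?_ ?_
  · rintro ⟨x, y, z⟩ h
    simp only [W, mem_filter, mem_univ, true_and, mem_sigma, mem_erase] at h ⊢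
    obtain ⟨h1, h3, h4, h5⟩ := h
    have e1 : x + (x + y) = y := by linear_combination x * h2
    have e2 : z + (x + y) = x + y + z := by ring
    rw [e1, e2]
    refine ⟨⟨fun h => h1 (by linear_combination h - y * h2), trivial⟩, Ne.symm h3, Ne.symm h4, ?_⟩
    linear_combination h5 - (G z + G (x + y + z)) * h2
  · rintro ⟨a, x, z⟩ h
    simp only [W, mem_filter, mem_univ, true_and, mem_sigma, mem_erase] at h ⊢
    obtain ⟨⟨h1, -⟩, h3, h4, h5⟩ := h
    have e1 : x + (a + x) + z = z + a := by linear_combination x * h2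
    rw [e1, add_comm a x]
    refine ⟨fun h => h1 (by linear_combination -h), Ne.symm h3, Ne.symm h4, ?_⟩
    linear_combination h5 + (G z + G (z + a)) * h2
  · rintro ⟨x, y, z⟩ h
    simp only [Sigma.mk.injEq, heq_eq_eq, true_and, and_true]
    linear_combination x * h2
  · rintro ⟨a, x, z⟩ h
    simp only [Sigma.mk.injEq, heq_eq_eq, and_true]
    linear_combination x * h2

theorem Tr_one {K : Type*} [Field K] (n : ℕ) : Tr n (1 : K) = n := by simp [Tr]

theorem Tr_two_mul_of_sq_eq_add_one {K : Type*} [Field K] [CharP K 2] {w : K}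
    (hw : w ^ 2 = w + 1) (m : ℕ) : Tr (2 * m) w = m := by
  have h2 : (2 : K) = 0 := CharTwo.two_eq_zero
  have hpow : ∀ m : ℕ, w ^ 2 ^ (2 * m) = w := by
    intro m
    induction m with
    | zero => simp
    | succ m ih =>
      rw [mul_add, pow_add, pow_mul, ih]
      linear_combination (w ^ 2 + w + 2) * hw + (w + 1) * h2
  induction m with
  | zero => simp [Tr]
  | succ m ih =>
    rw [Tr] at ih ⊢
    rw [mul_add, mul_one, Finset.sum_range_succ, Finset.sum_range_succ, ih, pow_succ 2 (2 * m),
      pow_mul w (2 ^ (2 * m)) 2, hpow, hw]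
    push_cast
    linear_combination w * h2

section Fmod

variable {K : Type*} [Field K] [DecidableEq K] {α : K}

@[simp]
theorem Fmod_zero : Fmod α 0 = α⁻¹ := by simp [Fmod]

@[simp]
theorem Fmod_self (hα : α ≠ 0) : Fmod α α = 0 := by simp [Fmod, hα]

theorem Fmod_apply {x : K} (h0 : x ≠ 0) (h1 : x ≠ α) : Fmod α x = x⁻¹ := by simp [Fmod, h0, h1]

theorem Fmod_add_Fmod [CharP K 2] {a x : K} (h0 : x ≠ 0) (h1 : x ≠ α) (ha : x ≠ a)
    (hαa : x ≠ α + a) : Fmod α x + Fmod α (x + a) = a / (x ^ 2 + a * x) := by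
  have h2 : (2 : K) = 0 := CharTwo.two_eq_zero
  have h3 : x + a ≠ 0 := fun h => ha (by linear_combination h - a * h2)
  have h4 : x + a ≠ α := fun h => hαa (by linear_combination h - a * h2)
  have h5 : x ^ 2 + a * x = x * (x + a) := by ring
  rw [Fmod_apply h0 h1, Fmod_apply h3 h4, h5]
  field_simp
  linear_combination x * h2

theorem Fmod_add_Fmod_eq_iff [CharP K 2] {a x : K} (hα : α ≠ 0) (ha : a ≠ 0) (haα : a ≠ α)
    (h0 : x ≠ 0) (h1 : x ≠ α) (hxa : x ≠ a) (hαa : x ≠ α + a) :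
    (Fmod α x + Fmod α (x + a) = α⁻¹ + a⁻¹ ↔ x ^ 2 + a * x = a ^ 2 * α / (a + α)) ∧
    (Fmod α x + Fmod α (x + a) = (α + a)⁻¹ ↔ x ^ 2 + a * x = a * (a + α)) := by
  have h2 : (2 : K) = 0 := CharTwo.two_eq_zero
  have hs : a + α ≠ 0 := fun h => haα (by linear_combination h - α * h2)
  have hs' : α + a ≠ 0 := by rwa [add_comm]
  have h3 : x ^ 2 + a * x ≠ 0 := by
    have h5 : x ^ 2 + a * x = x * (x + a) := by ring
    rw [h5]
    exact mul_ne_zero h0 fun h => hxa (by linear_combination h - a * h2)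
  have h4 : α⁻¹ + a⁻¹ = (a + α) / (α * a) := by field_simp
  rw [Fmod_add_Fmod h0 h1 hxa hαa, h4, div_eq_div_iff h3 (mul_ne_zero hα ha), eq_div_iff hs,
    inv_eq_one_div, div_eq_div_iff h3 hs']
  refine ⟨⟨fun h => ?_, fun h => ?_⟩, ⟨fun h => ?_, fun h => ?_⟩⟩ <;> linear_combination -h

end Fmod

theorem sq_add_mul_ne_of_special {K : Type*} [Field K] [CharP K 2] {α a x : K} (hα : α ≠ 0) (ha : a ≠ 0) (haα : a ≠ α)
    (hx : x = 0 ∨ x = α ∨ x = a ∨ x = α + a) :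
    x ^ 2 + a * x ≠ a ^ 2 * α / (a + α) ∧ x ^ 2 + a * x ≠ a * (a + α) := by
  have h2 : (2 : K) = 0 := CharTwo.two_eq_zero
  have hs : a + α ≠ 0 := fun h => haα (by linear_combination h - α * h2)
  rw [Ne, eq_div_iff hs]
  have e1 : a ^ 2 * α ≠ 0 := mul_ne_zero (pow_ne_zero 2 ha) hα
  have e2 : a * (a + α) ≠ 0 := mul_ne_zero ha hs
  have e3 : α ^ 3 ≠ 0 := pow_ne_zero 3 hα
  have e4 : (a + α) ^ 2 ≠ 0 := pow_ne_zero 2 hs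
  rcases hx with rfl | rfl | rfl | rfl <;> refine ⟨fun h => ?_, fun h => ?_⟩
  · exact e1 (by linear_combination -h)
  · exact e2 (by linear_combination -h)
  · exact e3 (by linear_combination h - a * x ^ 2 * h2)
  · exact e4 (by linear_combination h + (a ^ 2 + a * x) * h2)
  · exact e1 (by linear_combination -h + (x ^ 3 + x ^ 2 * α) * h2)
  · exact e2 (by linear_combination -h + x ^ 2 * h2)
  · exact e3 (by linear_combination h - (2 * a * α ^ 2 + 2 * α * a ^ 2 + a ^ 3) * h2)
  · exact e4 (by linear_combination h)

section

variable [CharP F 2] {n : ℕ} {α a : F}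

theorem delta_Fmod_le_two (hα : α ≠ 0) (ha : a ≠ 0) {b : F}
    (hb0 : b ≠ α⁻¹ + Fmod α a) (hb1 : b ≠ Fmod α (α + a)) : delta (Fmod α) a b ≤ 2 := by
  have h2 : (2 : F) = 0 := CharTwo.two_eq_zero
  have key : ∀ x : F, Fmod α x + Fmod α (x + a) = b →
      x ^ 2 + a * x ≠ 0 ∧ a / (x ^ 2 + a * x) = b := by
    intro x hx
    have h0 : x ≠ 0 := by
      rintro rfl
      simp [← hx] at hb0
    have h1 : x ≠ α := by
      rintro rfl
      simp [← hx, hα] at hb1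
    have h3 : x ≠ a := by
      rintro rfl
      simp [← hx, CharTwo.add_self_eq_zero, add_comm] at hb0
    have h4 : x ≠ α + a := by
      rintro rfl
      simp [← hx, add_assoc, CharTwo.add_self_eq_zero, hα] at hb1
    rw [← Fmod_add_Fmod h0 h1 h3 h4]
    refine ⟨?_, hx⟩
    have h5 : x ^ 2 + a * x = x * (x + a) := by ring
    rw [h5]
    exact mul_ne_zero h0 fun h => h3 (by linear_combination h - a * h2)
  rw [delta]
  rcases (univ.filter fun x : F => Fmod α x + Fmod α (x + a) = b).eq_empty_or_nonempty
    with h | ⟨y, hy⟩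
  · simp [h]
  · refine (Finset.card_le_card (t := {y, y + a}) fun z hz => ?_).trans Finset.card_le_two
    rw [mem_filter_univ] at hy hz
    obtain ⟨hy0, hy⟩ := key y hy
    obtain ⟨hz0, hz⟩ := key z hz
    have hyz := hy.trans hz.symm
    rw [div_eq_div_iff hy0 hz0] at hyz
    have hyz := mul_left_cancel₀ ha hyz
    have : (z - y) * (z - (y + a)) = 0 := by
      linear_combination hyz + (y ^ 2 + a * y - y * z - a * z) * h2
    rcases mul_eq_zero.mp this with h | h <;> simp [sub_eq_zero.mp h]

theorem collisions_Fmod_self (hn : 0 < n) (hcard : Fintype.card F = 2 ^ n) (hα : α ≠ 0) :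
    collisions (Fmod α) α = 0 ∨ collisions (Fmod α) α = 8 := by
  have h2 : (2 : F) = 0 := CharTwo.two_eq_zero
  have hsum : collisions (Fmod α) α = delta (Fmod α) α α⁻¹ * (delta (Fmod α) α α⁻¹ - 2) := by
    refine Finset.sum_eq_single _ (fun b _ hb => ?_) (by simp)
    have := delta_Fmod_le_two hα hα (b := b) (by simpa [hα] using hb)
      (by simpa [hα, CharTwo.add_self_eq_zero] using hb)
    rw [Nat.sub_eq_zero_of_le this, mul_zero]
  have hδ : delta (Fmod α) α α⁻¹ = 2 + (univ.filter fun x : F => x ^ 2 + α * x = α ^ 2).card := by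
    have : (univ.filter fun x : F => Fmod α x + Fmod α (x + α) = α⁻¹) =
        {0, α} ∪ univ.filter fun x : F => x ^ 2 + α * x = α ^ 2 := by
      ext x
      simp only [mem_filter_univ, mem_union, mem_insert, mem_singleton]
      by_cases h0 : x = 0
      · simp [h0, hα]
      by_cases h1 : x = α
      · simp [h1, hα, CharTwo.add_self_eq_zero]
      have h3 : x ^ 2 + α * x ≠ 0 := by
        have h5 : x ^ 2 + α * x = x * (x + α) := by ring
        rw [h5]
        exact mul_ne_zero h0 fun h => h1 (by linear_combination h - α * h2)
      rw [Fmod_add_Fmod h0 h1 h1 (by rwa [CharTwo.add_self_eq_zero])]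
      simp only [h0, h1, false_or]
      rw [inv_eq_one_div, div_eq_div_iff h3 hα]
      constructor <;> intro h <;> linear_combination -h
    rw [delta, this, Finset.card_union_of_disjoint, Finset.card_pair hα.symm]
    rw [Finset.disjoint_left]
    intro x hx
    rw [mem_filter_univ]
    rw [mem_insert, mem_singleton] at hx
    have := pow_ne_zero 2 hα
    rcases hx with rfl | rfl
    · simpa using this.symm
    · intro h
      exact this (by linear_combination h)
  rw [hsum, hδ, card_sq_add_mul_eq hn hcard hα]
  split_ifs <;> simp

theorem card_Fmod_fibers (hn : 0 < n) (hcard : Fintype.card F = 2 ^ n) (hα : α ≠ 0)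
    (ha : a ≠ 0) :
    (univ.filter fun x : F => x ^ 2 + a * x = a ^ 2 * α / (a + α)).card =
      (if Tr n (α / (a + α)) = 0 then 2 else 0) ∧
    (univ.filter fun x : F => x ^ 2 + a * x = a * (a + α)).card =
      (if Tr n (α / a) = Tr n 1 then 2 else 0) := by
  have h1 : a ^ 2 * α / (a + α) / a ^ 2 = α / (a + α) := by
    field_simp
  have h2 : a * (a + α) / a ^ 2 = α / a + 1 := by
    field_simp
    ring
  rw [card_sq_add_mul_eq hn hcard ha, card_sq_add_mul_eq hn hcard ha, h1, h2, Tr_add]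
  simp only [CharTwo.add_eq_zero, and_self]

theorem collisions_Fmod_of_ne (hn : 0 < n) (hcard : Fintype.card F = 2 ^ n) (hα : α ≠ 0)
    (ha : a ≠ 0) (haα : a ≠ α) (h : a ^ 2 + a * α + α ^ 2 ≠ 0) :
    collisions (Fmod α) a = (if Tr n (α / (a + α)) = 0 then 8 else 0) +
      (if Tr n (α / a) = Tr n 1 then 8 else 0) := by
  have h2 : (2 : F) = 0 := CharTwo.two_eq_zero
  have hs : a + α ≠ 0 := fun h => haα (by linear_combination h - α * h2)
  have hs' : α + a ≠ 0 := by rwa [add_comm]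
  have hFa : Fmod α a = a⁻¹ := Fmod_apply ha haα
  have hFs : Fmod α (α + a) = (α + a)⁻¹ := Fmod_apply hs' (by simpa using ha)
  have hne : α⁻¹ + a⁻¹ ≠ (α + a)⁻¹ := by
    intro h'
    field_simp at h'
    exact h (by linear_combination h')
  have hsum : collisions (Fmod α) a =
      delta (Fmod α) a (α⁻¹ + a⁻¹) * (delta (Fmod α) a (α⁻¹ + a⁻¹) - 2) +
      delta (Fmod α) a (α + a)⁻¹ * (delta (Fmod α) a (α + a)⁻¹ - 2) := by
    refine Finset.sum_eq_add _ _ hne (fun b _ hb => ?_) (by simp) (by simp)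
    have := delta_Fmod_le_two hα ha (b := b) (by simpa [hFa] using hb.1) (by simpa [hFs] using hb.2)
    rw [Nat.sub_eq_zero_of_le this, mul_zero]
  obtain ⟨c1, c2⟩ := card_Fmod_fibers hn hcard hα ha
  have hδ0 : delta (Fmod α) a (α⁻¹ + a⁻¹) = 2 + if Tr n (α / (a + α)) = 0 then 2 else 0 := by
    have : (univ.filter fun x : F => Fmod α x + Fmod α (x + a) = α⁻¹ + a⁻¹) =
        {0, a} ∪ univ.filter fun x : F => x ^ 2 + a * x = a ^ 2 * α / (a + α) := by
      ext x
      simp only [mem_filter_univ, mem_union, mem_insert, mem_singleton]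
      by_cases h0 : x = 0
      · simp [h0, hFa]
      by_cases h3 : x = a
      · simp [h3, hFa, CharTwo.add_self_eq_zero, add_comm]
      by_cases h1 : x = α
      · have := (sq_add_mul_ne_of_special hα ha haα (Or.inr (Or.inl h1))).1
        simp only [h0, h3, this, or_self, iff_false]
        rw [h1, Fmod_self hα, hFs, zero_add]
        exact hne.symm
      by_cases h4 : x = α + a
      · have := (sq_add_mul_ne_of_special hα ha haα (Or.inr (Or.inr (Or.inr h4)))).1
        simp only [h0, h3, this, or_self, iff_false]
        rw [h4, add_assoc, CharTwo.add_self_eq_zero, add_zero, Fmod_self hα, hFs, add_zero]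
        exact hne.symm
      simp [h0, h3, (Fmod_add_Fmod_eq_iff hα ha haα h0 h1 h3 h4).1]
    rw [delta, this, Finset.card_union_of_disjoint, Finset.card_pair ha.symm, c1]
    rw [Finset.disjoint_left]
    intro x hx
    rw [mem_filter_univ]
    rw [mem_insert, mem_singleton] at hx
    exact (sq_add_mul_ne_of_special hα ha haα (by tauto)).1
  have hδ1 : delta (Fmod α) a (α + a)⁻¹ = 2 + if Tr n (α / a) = Tr n 1 then 2 else 0 := by
    have : (univ.filter fun x : F => Fmod α x + Fmod α (x + a) = (α + a)⁻¹) =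
        {α, α + a} ∪ univ.filter fun x : F => x ^ 2 + a * x = a * (a + α) := by
      ext x
      simp only [mem_filter_univ, mem_union, mem_insert, mem_singleton]
      by_cases h1 : x = α
      · simp [h1, hFs, hα]
      by_cases h4 : x = α + a
      · simp [h4, hFs, CharTwo.add_self_eq_zero, hα, add_assoc]
      by_cases h0 : x = 0
      · have := (sq_add_mul_ne_of_special hα ha haα (Or.inl h0)).2
        simp only [h1, h4, this, or_self, iff_false]
        rw [h0, Fmod_zero, zero_add, hFa]
        exact hne
      by_cases h3 : x = a
      · have := (sq_add_mul_ne_of_special hα ha haα (Or.inr (Or.inr (Or.inl h3)))).2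
        simp only [h1, h4, this, or_self, iff_false]
        rw [h3, CharTwo.add_self_eq_zero, Fmod_zero, hFa, add_comm]
        exact hne
      simp [h1, h4, (Fmod_add_Fmod_eq_iff hα ha haα h0 h1 h3 h4).2]
    rw [delta, this, Finset.card_union_of_disjoint, Finset.card_pair (by simpa using ha), c2]
    rw [Finset.disjoint_left]
    intro x hx
    rw [mem_filter_univ]
    rw [mem_insert, mem_singleton] at hx
    exact (sq_add_mul_ne_of_special hα ha haα (by tauto)).2
  rw [hsum, hδ0, hδ1]
  split_ifs <;> simp

theorem collisions_Fmod_of_eq (hn : 0 < n) (hcard : Fintype.card F = 2 ^ n) (hα : α ≠ 0)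
    (ha : a ≠ 0) (haα : a ≠ α) (h : a ^ 2 + a * α + α ^ 2 = 0) :
    collisions (Fmod α) a = if Tr n (α / (a + α)) = 0 then 24 else 8 := by
  have h2 : (2 : F) = 0 := CharTwo.two_eq_zero
  have hs : a + α ≠ 0 := fun h => haα (by linear_combination h - α * h2)
  have hs' : α + a ≠ 0 := by rwa [add_comm]
  have hFa : Fmod α a = a⁻¹ := Fmod_apply ha haα
  have hFs : Fmod α (α + a) = (α + a)⁻¹ := Fmod_apply hs' (by simpa using ha)
  have heq : (α + a)⁻¹ = α⁻¹ + a⁻¹ := by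
    field_simp
    linear_combination -h
  have hsum : collisions (Fmod α) a =
      delta (Fmod α) a (α⁻¹ + a⁻¹) * (delta (Fmod α) a (α⁻¹ + a⁻¹) - 2) := by
    refine Finset.sum_eq_single _ (fun b _ hb => ?_) (by simp)
    have := delta_Fmod_le_two hα ha (b := b) (by simpa [hFa] using hb)
      (by simpa [hFs, heq] using hb)
    rw [Nat.sub_eq_zero_of_le this, mul_zero]
  have hδ0 : delta (Fmod α) a (α⁻¹ + a⁻¹) = 4 + if Tr n (α / (a + α)) = 0 then 2 else 0 := by
    have : (univ.filter fun x : F => Fmod α x + Fmod α (x + a) = α⁻¹ + a⁻¹) =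
        {0, α, a, α + a} ∪ univ.filter fun x : F => x ^ 2 + a * x = a ^ 2 * α / (a + α) := by
      ext x
      simp only [mem_filter_univ, mem_union, mem_insert, mem_singleton]
      by_cases h0 : x = 0
      · simp [h0, hFa]
      by_cases h3 : x = a
      · simp [h3, hFa, CharTwo.add_self_eq_zero, add_comm]
      by_cases h1 : x = α
      · simp [h1, hα, hFs, heq]
      by_cases h4 : x = α + a
      · simp [h4, hFs, heq, CharTwo.add_self_eq_zero, hα, add_assoc]
      simp [h0, h1, h3, h4, (Fmod_add_Fmod_eq_iff hα ha haα h0 h1 h3 h4).1]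
    have hcard4 : ({0, α, a, α + a} : Finset F).card = 4 := by
      rw [Finset.card_insert_of_notMem, Finset.card_insert_of_notMem,
        Finset.card_pair] <;> simp [hα, ha, haα.symm, hα.symm, ha.symm, hs'.symm]
    rw [delta, this, Finset.card_union_of_disjoint, hcard4,
      (card_Fmod_fibers hn hcard hα ha).1]
    rw [Finset.disjoint_left]
    intro x hx
    rw [mem_filter_univ]
    simp only [mem_insert, mem_singleton] at hx
    exact (sq_add_mul_ne_of_special hα ha haα hx).1
  rw [hsum, hδ0]
  split_ifs <;> simp

end

theorem sum_collisions_add_card_RSpec [CharP F 2] (G : F → F) :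
    24 * (VF G).ncard + 8 * (RSpec G).card =
      ∑ a ∈ univ.erase (0 : F), (collisions G a + if collisions G a = 0 then 8 else 0) := by
  rw [Finset.sum_add_distrib, twentyFour_mul_ncard_VF, RSpec, Finset.card_filter, Finset.mul_sum]
  congr 1
  refine Finset.sum_congr rfl fun a ha => ?_
  simp [twoToOne_iff_collisions_eq_zero G (Finset.ne_of_mem_erase ha)]

theorem sum_erase_zero_indicator {n : ℕ} (hcard : Fintype.card F = 2 ^ n) (p : F → Prop)
    [DecidablePred p] (h0 : ¬ p 0) :
    ∑ a ∈ univ.erase (0 : F), (8 + if p a then 8 else 0) + 8 =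
      8 * 2 ^ n + 8 * (univ.filter p).card := by
  have h := Finset.sum_erase_add univ (fun a : F => 8 + if p a then 8 else 0) (mem_univ 0)
  rw [Finset.sum_add_distrib (s := univ), Finset.sum_const, Finset.card_univ, hcard] at h
  rw [Finset.card_filter, Finset.mul_sum]
  simp only [mul_ite, mul_one, mul_zero]
  simp only [h0, if_false, add_zero, smul_eq_mul] at h
  rw [h, mul_comm]

theorem collisions_Fmod_self_add [CharP F 2] {n : ℕ} {α : F} (hn : 0 < n)
    (hcard : Fintype.card F = 2 ^ n) (hα : α ≠ 0) :
    (collisions (Fmod α) α + if collisions (Fmod α) α = 0 then 8 else 0) = 8 := by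
  rcases collisions_Fmod_self hn hcard hα with h | h <;> simp [h]

theorem collisions_Fmod_add [CharP F 2] {n : ℕ} {α a : F} (hn : 0 < n)
    (hcard : Fintype.card F = 2 ^ n) (hα : α ≠ 0)
    (ha : a ≠ 0) (haα : a ≠ α) (h : a ^ 2 + a * α + α ^ 2 ≠ 0) :
    (collisions (Fmod α) a + if collisions (Fmod α) a = 0 then 8 else 0) =
      8 + if Tr n (α / (a + α)) = 0 ∧ Tr n (α / a) = Tr n 1 then 8 else 0 := by
  rw [collisions_Fmod_of_ne hn hcard hα ha haα h]
  by_cases h1 : Tr n (α / (a + α)) = 0 <;> by_cases h3 : Tr n (α / a) = Tr n 1 <;> simp [h1, h3]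

theorem sum_collisions_odd [CharP F 2] {n : ℕ} {α : F} (hn : 0 < n)
    (hcard : Fintype.card F = 2 ^ n) (hα : α ≠ 0) (hodd : Odd n) :
    24 * (VF (Fmod α)).ncard + 8 * (RSpec (Fmod α)).card + 8 =
      8 * 2 ^ n + 8 * (univ.filter fun a : F =>
        a ≠ 0 ∧ a ≠ α ∧ Tr n (α / (a + α)) = 0 ∧ Tr n (α / a) = 1).card := by
  have hTr : Tr n (1 : F) = 1 := by rw [Tr_one, CharTwo.natCast_eq_ite]; simp [hodd]
  rw [sum_collisions_add_card_RSpec, ← sum_erase_zero_indicator hcard _ (by simp)]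
  congr 1
  refine Finset.sum_congr rfl fun a ha => ?_
  have ha := Finset.ne_of_mem_erase ha
  by_cases haα : a = α
  · subst haα
    simp [collisions_Fmod_self_add hn hcard hα]
  have h : a ^ 2 + a * α + α ^ 2 ≠ 0 := by
    intro h
    have := Tr_sq_add_self hcard (a / α)
    rw [show (a / α) ^ 2 + a / α = 1 by
      field_simp
      linear_combination h - α ^ 2 * CharTwo.two_eq_zero (R := F), hTr] at this
    exact one_ne_zero this
  simp [collisions_Fmod_add hn hcard hα ha haα h, hTr, ha, haα]

theorem sum_collisions_even [CharP F 2] {m : ℕ} {α ω : F} (hn : 0 < 2 * m)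
    (hcard : Fintype.card F = 2 ^ (2 * m)) (hα : α ≠ 0) (hω : ω ^ 2 = ω + 1) :
    24 * (VF (Fmod α)).ncard + 8 * (RSpec (Fmod α)).card + 8 =
      8 * 2 ^ (2 * m) + 8 * (univ.filter fun a : F =>
        a ≠ 0 ∧ a ≠ α ∧ a ≠ α * ω ∧ a ≠ α * ω ^ 2 ∧
        Tr (2 * m) (α / (a + α)) = 0 ∧ Tr (2 * m) (α / a) = 0).card +
      if Even m then 32 else 0 := by
  have h2 : (2 : F) = 0 := CharTwo.two_eq_zero
  have hTr1 : Tr (2 * m) (1 : F) = 0 := by simp [Tr_one, h2]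
  have hTr : Tr (2 * m) ω = 0 ↔ Even m := by
    rw [Tr_two_mul_of_sq_eq_add_one hω, CharTwo.natCast_eq_ite]
    simp
  have hroots : ∀ a : F, a ^ 2 + a * α + α ^ 2 = 0 ↔ a ∈ ({α * ω, α * ω ^ 2} : Finset F) := by
    intro a
    rw [mem_insert, mem_singleton, ← sub_eq_zero (b := α * ω), ← sub_eq_zero (b := α * ω ^ 2),
      ← mul_eq_zero]
    have : (a - α * ω) * (a - α * ω ^ 2) = a ^ 2 + a * α + α ^ 2 := by
      linear_combination (α ^ 2 * ω + α ^ 2 - a * α) * hω + (α ^ 2 * ω - a * α * ω - a * α) * h2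
    rw [this]
  have hdiv : ∀ a ∈ ({α * ω, α * ω ^ 2} : Finset F),
      a ≠ 0 ∧ a ≠ α ∧ Tr (2 * m) (α / (a + α)) = Tr (2 * m) ω := by
    intro a ha
    have h := (hroots a).mpr ha
    have ha0 : a ≠ 0 := by
      rintro rfl
      exact pow_ne_zero 2 hα (by linear_combination h)
    have haα : a ≠ α := by
      rintro rfl
      exact pow_ne_zero 2 hα (by linear_combination h - a ^ 2 * h2)
    have hs : a + α ≠ 0 := fun h => haα (by linear_combination h - α * h2)
    refine ⟨ha0, haα, ?_⟩
    rw [mem_insert, mem_singleton] at ha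
    rcases ha with rfl | rfl
    · congr 1
      rw [div_eq_iff hs]
      linear_combination -α * hω - α * ω * h2
    · have : α / (α * ω ^ 2 + α) = ω + 1 := by
        rw [div_eq_iff hs]
        linear_combination -(α * ω + 2 * α) * hω - (2 * α * ω + α) * h2
      rw [this, Tr_add, hTr1, add_zero]
  rw [sum_collisions_add_card_RSpec, ← sum_erase_zero_indicator hcard _ (by simp)]
  have hsp : ∑ a ∈ univ.erase (0 : F),
      (if a ∈ ({α * ω, α * ω ^ 2} : Finset F) then (if Even m then 16 else 0) else 0) =
        if Even m then 32 else 0 := by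
    rw [← Finset.sum_filter, Finset.sum_const]
    have : ((univ.erase (0 : F)).filter fun a => a ∈ ({α * ω, α * ω ^ 2} : Finset F)) =
        {α * ω, α * ω ^ 2} := by
      ext a
      simp only [mem_filter, mem_erase, mem_univ, and_true, and_iff_right_iff_imp]
      exact fun h => (hdiv a h).1
    rw [this, Finset.card_pair]
    · split_ifs <;> simp
    · intro h
      have := mul_left_cancel₀ hα h
      exact one_ne_zero (α := F) (by linear_combination -this - hω)
  rw [add_right_comm, ← hsp, ← Finset.sum_add_distrib]
  congr 1
  refine Finset.sum_congr rfl fun a ha => ?_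
  have ha := Finset.ne_of_mem_erase ha
  by_cases hr : a ∈ ({α * ω, α * ω ^ 2} : Finset F)
  · obtain ⟨-, haα, h⟩ := hdiv a hr
    rw [collisions_Fmod_of_eq hn hcard hα ha haα ((hroots a).mpr hr), if_pos hr, h]
    simp only [hTr]
    rw [mem_insert, mem_singleton] at hr
    have : ¬ (a ≠ α * ω ∧ a ≠ α * ω ^ 2) := by tauto
    rw [if_neg (c := a ≠ 0 ∧ _) (by tauto)]
    split_ifs <;> simp_all
  rw [if_neg hr]
  have hr' := hr
  rw [mem_insert, mem_singleton, not_or] at hr'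
  by_cases haα : a = α
  · subst haα
    simp [collisions_Fmod_self_add hn hcard hα]
  simp [collisions_Fmod_add hn hcard hα ha haα ((hroots a).not.mpr hr), hTr1, ha, haα, hr'.1,
    hr'.2]

/-- the number of vanishing flats of `F_{0,α}`. -/
theorem stmt_15 (n : ℕ) (hn : 0 < n)
    [CharP F 2] (hcard : Fintype.card F = 2 ^ n)
    (α : F) (hα : α ≠ 0) (ω : F) (hω : Even n → ω ^ 2 = ω + 1) (k ℓ s : ℕ)
    (hk : k = (RSpec (Fmod α)).card)
    (hℓ : ℓ = ((Finset.univ.filter fun a : F =>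
      a ≠ 0 ∧ a ≠ α ∧ Tr n (α / (a + α)) = 0 ∧ Tr n (α / a) = 1)).card)
    (hs : s = ((Finset.univ.filter fun a : F =>
      a ≠ 0 ∧ a ≠ α ∧ a ≠ α * ω ∧ a ≠ α * ω ^ 2 ∧
        Tr n (α / (a + α)) = 0 ∧ Tr n (α / a) = 0)).card) :
    (Odd n → 3 ≤ n →
      3 * ((VF (Fmod α)).ncard : ℤ) = (2 : ℤ) ^ n + (ℓ : ℤ) - (k : ℤ) - 1) ∧
    (n % 4 = 2 →
      3 * ((VF (Fmod α)).ncard : ℤ) = (2 : ℤ) ^ n + (s : ℤ) - (k : ℤ) - 1) ∧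
    (n % 4 = 0 → 4 ≤ n →
      3 * ((VF (Fmod α)).ncard : ℤ) = (2 : ℤ) ^ n + (s : ℤ) - (k : ℤ) + 3) := by
  refine ⟨fun hodd _ => ?_, fun hmod => ?_, fun hmod _ => ?_⟩
  · have := sum_collisions_odd hn hcard hα hodd
    rw [← hk, ← hℓ] at this
    zify at this
    linarith
  · obtain ⟨m, rfl⟩ : ∃ m, n = 2 * m := ⟨n / 2, by omega⟩
    have := sum_collisions_even hn hcard hα (hω (even_two_mul m))
    rw [← hk, ← hs, if_neg (by rw [Nat.even_iff]; omega)] at this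
    zify at this
    linarith
  · obtain ⟨m, rfl⟩ : ∃ m, n = 2 * m := ⟨n / 2, by omega⟩
    have := sum_collisions_even hn hcard hα (hω (even_two_mul m))
    rw [← hk, ← hs, if_pos (by rw [Nat.even_iff]; omega)] at this
    zify at this
    linarith

end APNPaper
end
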